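/- arXiv:1808.06563 — 2 statements merged into one kernel-verified Lean document; each statement's English description precedes it below -/
import Mathlib

section
/- For 0 < β ≤ 1 the Laplace transform of φ(t) = -d/dt E_β(-t^β) is 1/(1+s^β) for s > 0. -/
noncomputable def laplace (f : ℝ → ℝ) (s : ℝ) : ℝ :=
  ∫ t in Set.Ioi (0:ℝ), Real.exp (-s * t) * f t

noncomputable def mittagLeffler (β x : ℝ) : ℝ :=
  ∑' n : ℕ, x ^ n / Real.Gamma (β * n + 1)

open Set Filter Topology MeasureTheory

/-- The first `n` derivatives of `f` on `(0, ∞)` exist and alternate in sign, starting with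
`0 ≤ f`. -/
def AlternatingDerivs : ℕ → (ℝ → ℝ) → Prop
  | 0, f => ∀ x, 0 < x → 0 ≤ f x
  | n + 1, f => (∀ x, 0 < x → 0 ≤ f x) ∧
      ∃ g, AlternatingDerivs n g ∧ ∀ x, 0 < x → HasDerivAt f (-g x) x

namespace AlternatingDerivs

lemma nonneg {n : ℕ} {f : ℝ → ℝ} (hf : AlternatingDerivs n f) {x : ℝ} (hx : 0 < x) :
    0 ≤ f x := by
  cases n with
  | zero => exact hf x hx
  | succ n => exact hf.1 x hx

lemma of_succ {n : ℕ} {f : ℝ → ℝ} (hf : AlternatingDerivs (n + 1) f) :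
    AlternatingDerivs n f := by
  induction n generalizing f with
  | zero => exact hf.1
  | succ n ih =>
    obtain ⟨h0, g, hg, hfg⟩ := hf
    exact ⟨h0, g, ih hg, hfg⟩

lemma add {n : ℕ} {f g : ℝ → ℝ} (hf : AlternatingDerivs n f) (hg : AlternatingDerivs n g) :
    AlternatingDerivs n (fun x => f x + g x) := by
  induction n generalizing f g with
  | zero => exact fun x hx => add_nonneg (hf x hx) (hg x hx)
  | succ n ih =>
    obtain ⟨hf0, f', hf', hff'⟩ := hf
    obtain ⟨hg0, g', hg', hgg'⟩ := hg
    refine ⟨fun x hx => add_nonneg (hf0 x hx) (hg0 x hx), _, ih hf' hg', fun x hx => ?_⟩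
    exact ((hff' x hx).add (hgg' x hx)).congr_deriv (by ring)

lemma mul {n : ℕ} {f g : ℝ → ℝ} (hf : AlternatingDerivs n f) (hg : AlternatingDerivs n g) :
    AlternatingDerivs n (fun x => f x * g x) := by
  induction n generalizing f g with
  | zero => exact fun x hx => mul_nonneg (hf x hx) (hg x hx)
  | succ n ih =>
    have hfn := hf.of_succ
    have hgn := hg.of_succ
    obtain ⟨hf0, f', hf', hff'⟩ := hf
    obtain ⟨hg0, g', hg', hgg'⟩ := hg
    refine ⟨fun x hx => mul_nonneg (hf0 x hx) (hg0 x hx), _, (ih hf' hgn).add (ih hfn hg'),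
      fun x hx => ?_⟩
    exact ((hff' x hx).mul (hgg' x hx)).congr_deriv (by ring)

lemma const_mul {n : ℕ} {f : ℝ → ℝ} {c : ℝ} (hc : 0 ≤ c) (hf : AlternatingDerivs n f) :
    AlternatingDerivs n (fun x => c * f x) := by
  induction n generalizing f with
  | zero => exact fun x hx => mul_nonneg hc (hf x hx)
  | succ n ih =>
    obtain ⟨hf0, f', hf', hff'⟩ := hf
    refine ⟨fun x hx => mul_nonneg hc (hf0 x hx), _, ih hf', fun x hx => ?_⟩
    exact ((hff' x hx).const_mul c).congr_deriv (by ring)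

lemma antitoneOn {n : ℕ} {f : ℝ → ℝ} (hf : AlternatingDerivs (n + 1) f) :
    AntitoneOn f (Ioi 0) := by
  obtain ⟨-, g, hg, hfg⟩ := hf
  refine antitoneOn_of_deriv_nonpos (convex_Ioi 0)
    (fun x hx => (hfg x hx).continuousAt.continuousWithinAt)
    (fun x hx => ?_) (fun x hx => ?_) <;> rw [interior_Ioi] at hx
  · exact (hfg x hx).differentiableAt.differentiableWithinAt
  · rw [(hfg x hx).deriv]
    exact neg_nonpos.2 (hg.nonneg hx)

lemma sub_shift {n : ℕ} {f : ℝ → ℝ} (hf : AlternatingDerivs (n + 1) f) :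
    AlternatingDerivs n (fun x => f x - f (x + 1)) := by
  have key : ∀ x, 0 < x → 0 ≤ f x - f (x + 1) := fun x hx =>
    sub_nonneg.2 (hf.antitoneOn (mem_Ioi.2 hx) (mem_Ioi.2 (by linarith)) (by linarith))
  induction n generalizing f with
  | zero => exact key
  | succ n ih =>
    obtain ⟨-, g, hg, hfg⟩ := hf
    refine ⟨key, _, ih hg fun x hx => ?_, fun x hx => ?_⟩
    · exact sub_nonneg.2
        (hg.antitoneOn (mem_Ioi.2 hx) (mem_Ioi.2 (by linarith)) (by linarith))
    · exact ((hfg x hx).sub ((hfg (x + 1) (by linarith)).comp_add_const x 1)).congr_deriv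
        (by ring)

lemma rpow_neg (n : ℕ) {a : ℝ} (ha : 0 ≤ a) : AlternatingDerivs n (fun x => x ^ (-a)) := by
  induction n generalizing a with
  | zero => exact fun x hx => by positivity
  | succ n ih =>
    refine ⟨fun x hx => by positivity, _, (ih (a := a + 1) (by linarith)).const_mul ha,
      fun x hx => ?_⟩
    refine (Real.hasDerivAt_rpow_const (Or.inl hx.ne')).congr_deriv ?_
    rw [show -a - 1 = -(a + 1) by ring]
    ring

lemma inv_one_add_rpow (n : ℕ) {b : ℝ} (hb0 : 0 < b) (hb1 : b ≤ 1) :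
    AlternatingDerivs n (fun x => 1 / (1 + x ^ b)) := by
  induction n with
  | zero => exact fun x hx => by positivity
  | succ n ih =>
    refine ⟨fun x hx => by positivity, _,
      ((rpow_neg n (a := 1 - b) (by linarith)).mul (ih.mul ih)).const_mul hb0.le,
      fun x hx => ?_⟩
    have hpos : (1 : ℝ) + x ^ b ≠ 0 := by positivity
    have h := ((Real.hasDerivAt_rpow_const (p := b) (Or.inl hx.ne')).const_add 1).inv hpos
    simp only [one_div]
    refine h.congr_deriv ?_
    rw [show -(1 - b) = b - 1 by ring]
    field_simp

end AlternatingDerivs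

lemma integrableOn_exp_neg_mul_mul_of_bounded {f g : ℝ → ℝ} {s : ℝ}
    (hf : IntegrableOn (fun t => Real.exp (-s * t) * f t) (Ioi 0))
    (hg : Continuous g) {C : ℝ} (hC : ∀ t, 0 < t → |g t| ≤ C) :
    IntegrableOn (fun t => Real.exp (-s * t) * (g t * f t)) (Ioi 0) := by
  have : IntegrableOn (fun t => g t * (Real.exp (-s * t) * f t)) (Ioi 0) :=
    hf.bdd_mul hg.aestronglyMeasurable (c := C)
      ((ae_restrict_iff' measurableSet_Ioi).2 (Eventually.of_forall hC))
  refine this.congr_fun (fun t _ => ?_) measurableSet_Ioi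
  ring

lemma AlternatingDerivs.laplace_one_sub_exp_pow_mul_nonneg {m : ℕ} {f G : ℝ → ℝ} {c : ℝ}
    (hc : 0 ≤ c) (hG : AlternatingDerivs m G)
    (hint : ∀ s, c < s → IntegrableOn (fun t => Real.exp (-s * t) * f t) (Ioi 0))
    (hlap : ∀ s, c < s → laplace f s = G s) {s : ℝ} (hs : c < s) :
    0 ≤ laplace (fun t => (1 - Real.exp (-t)) ^ m * f t) s := by
  induction m generalizing f G with
  | zero => simpa [hlap s hs] using hG s (hc.trans_lt hs)
  | succ m ih =>
    have hshift : ∀ s t : ℝ, Real.exp (-s * t) * ((1 - Real.exp (-t)) * f t) =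
        Real.exp (-s * t) * f t - Real.exp (-(s + 1) * t) * f t := by
      intro s t
      rw [show -(s + 1) * t = -s * t + -t by ring, Real.exp_add]
      ring
    have := ih (f := fun t => (1 - Real.exp (-t)) * f t) hG.sub_shift
      (fun s hs => by
        simp only [hshift]
        exact (hint s hs).sub (hint (s + 1) (by linarith)))
      (fun s hs => by
        rw [← hlap s hs, ← hlap (s + 1) (by linarith)]
        simp only [laplace, hshift]
        exact integral_sub (hint s hs) (hint (s + 1) (by linarith)))
    simpa only [pow_succ, mul_assoc] using this

lemma integral_exp_mul_continuousMap_nonneg {f : ℝ → ℝ} {s : ℝ}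
    (hint : IntegrableOn (fun t => Real.exp (-s * t) * f t) (Ioi 0))
    (hmom : ∀ k m : ℕ, 0 ≤
      ∫ t in Ioi (0 : ℝ), Real.exp (-s * t) * (Real.exp (-t) ^ k * (1 - Real.exp (-t)) ^ m * f t))
    (g : C(unitInterval, ℝ)) (hg : ∀ x, 0 ≤ g x) :
    0 ≤ ∫ t in Ioi (0 : ℝ),
      Real.exp (-s * t) * (g (projIcc 0 1 zero_le_one (Real.exp (-t))) * f t) := by
  have hcont : ∀ g : C(unitInterval, ℝ),
      Continuous fun t : ℝ => g (projIcc 0 1 zero_le_one (Real.exp (-t))) := fun g =>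
    g.continuous.comp (continuous_projIcc.comp (by fun_prop))
  have hbound : ∀ (g : C(unitInterval, ℝ)) (t : ℝ),
      |g (projIcc 0 1 zero_le_one (Real.exp (-t)))| ≤ ‖g‖ := fun g t => g.norm_coe_le_norm _
  have hpoly : ∀ n : ℕ, 0 ≤ ∫ t in Ioi (0 : ℝ), Real.exp (-s * t) *
      (bernsteinApproximation n g (projIcc 0 1 zero_le_one (Real.exp (-t))) * f t) := by
    intro n
    have heq : ∀ t, Real.exp (-s * t) *
        (bernsteinApproximation n g (projIcc 0 1 zero_le_one (Real.exp (-t))) * f t) =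
        ∑ k : Fin (n + 1), g (bernstein.z k) * (Real.exp (-s * t) *
          (bernstein n k (projIcc 0 1 zero_le_one (Real.exp (-t))) * f t)) := by
      intro t
      simp only [bernsteinApproximation.apply, Finset.sum_mul, Finset.mul_sum, smul_eq_mul]
      exact Finset.sum_congr rfl fun k _ => by ring
    simp only [heq]
    rw [integral_finsetSum _ fun (k : Fin (n + 1)) _ => (Integrable.const_mul
      (integrableOn_exp_neg_mul_mul_of_bounded hint (hcont (bernstein n k))
        (fun t _ => hbound (bernstein n k) t)) (g (bernstein.z k)))]
    refine Finset.sum_nonneg fun k _ => ?_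
    rw [integral_const_mul]
    refine mul_nonneg (hg _) ?_
    have := mul_nonneg (Nat.cast_nonneg (α := ℝ) (n.choose k)) (hmom k (n - k))
    rw [← integral_const_mul] at this
    refine this.trans_eq (setIntegral_congr_fun measurableSet_Ioi fun t ht => ?_)
    have hmem : Real.exp (-t) ∈ Icc (0 : ℝ) 1 :=
      ⟨(Real.exp_pos _).le, Real.exp_le_one_iff.2 (neg_nonpos.2 (le_of_lt ht))⟩
    simp only [bernstein_apply, projIcc_of_mem zero_le_one hmem]
    ring
  have hlim : Tendsto (fun n : ℕ => ∫ t in Ioi (0 : ℝ), Real.exp (-s * t) *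
      (bernsteinApproximation n g (projIcc 0 1 zero_le_one (Real.exp (-t))) * f t)) atTop
      (𝓝 (∫ t in Ioi (0 : ℝ),
        Real.exp (-s * t) * (g (projIcc 0 1 zero_le_one (Real.exp (-t))) * f t))) := by
    have hB := bernsteinApproximation_uniform g
    have hnorm : ∀ᶠ n in atTop, ‖bernsteinApproximation n g‖ ≤ ‖g‖ + 1 :=
      (hB.norm.eventually_lt_const (lt_add_one _)).mono fun n hn => hn.le
    refine tendsto_integral_filter_of_dominated_convergence
      (fun t => (‖g‖ + 1) * ‖Real.exp (-s * t) * f t‖) ?_ ?_ (hint.norm.const_mul _) ?_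
    · exact Eventually.of_forall fun n => (integrableOn_exp_neg_mul_mul_of_bounded hint
        (hcont _) (fun t _ => hbound (bernsteinApproximation n g) t)).aestronglyMeasurable
    · filter_upwards [hnorm] with n hn
      refine Eventually.of_forall fun t => ?_
      rw [show ∀ a b c : ℝ, a * (b * c) = b * (a * c) by intros; ring, norm_mul]
      gcongr
      exact (hbound _ t).trans hn
    · refine Eventually.of_forall fun t => ?_
      exact (((continuous_eval_const _).tendsto g).comp hB |>.mul_const _).const_mul _
  exact ge_of_tendsto' hlim hpoly

lemma nonneg_of_laplace_moments_nonneg {f : ℝ → ℝ} {s : ℝ} (hf : ContinuousOn f (Ioi 0))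
    (hint : IntegrableOn (fun t => Real.exp (-s * t) * f t) (Ioi 0))
    (hmom : ∀ k m : ℕ, 0 ≤
      ∫ t in Ioi (0 : ℝ), Real.exp (-s * t) * (Real.exp (-t) ^ k * (1 - Real.exp (-t)) ^ m * f t))
    {t₀ : ℝ} (ht₀ : 0 < t₀) : 0 ≤ f t₀ := by
  by_contra! hneg
  have hcomp : ContinuousAt (fun x => f (-Real.log x)) (Real.exp (-t₀)) := by
    refine ContinuousAt.comp (f := fun x => -Real.log x) (g := f) ?_
      (Real.continuousAt_log (Real.exp_pos _).ne').neg
    rw [Real.log_exp, neg_neg]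
    exact hf.continuousAt (Ioi_mem_nhds ht₀)
  have hev : ∀ᶠ x in 𝓝 (Real.exp (-t₀)), f (-Real.log x) < 0 :=
    hcomp.eventually_lt_const (by simpa using hneg)
  obtain ⟨δ, hδ, hball⟩ := Metric.eventually_nhds_iff.1 hev
  let g : C(unitInterval, ℝ) := ⟨fun x => max 0 (δ - |(x : ℝ) - Real.exp (-t₀)|), by fun_prop⟩
  have hgval : ∀ t, 0 < t → g (projIcc 0 1 zero_le_one (Real.exp (-t))) =
      max 0 (δ - |Real.exp (-t) - Real.exp (-t₀)|) := by
    intro t ht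
    have hmem : Real.exp (-t) ∈ Icc (0 : ℝ) 1 :=
      ⟨(Real.exp_pos _).le, Real.exp_le_one_iff.2 (neg_nonpos.2 ht.le)⟩
    simp only [g, ContinuousMap.coe_mk, projIcc_of_mem zero_le_one hmem]
  have hfneg : ∀ t, |Real.exp (-t) - Real.exp (-t₀)| < δ → f t < 0 := by
    intro t ht
    simpa using hball (y := Real.exp (-t)) (by rwa [Real.dist_eq])
  have h0 := integral_exp_mul_continuousMap_nonneg hint hmom g (fun x => le_max_left _ _)
  have hI := integrableOn_exp_neg_mul_mul_of_bounded (f := f) hint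
    (g := fun t => g (projIcc 0 1 zero_le_one (Real.exp (-t))))
    (g.continuous.comp (continuous_projIcc.comp (by fun_prop)))
    (C := ‖g‖) (fun t _ => g.norm_coe_le_norm _)
  have hpos : 0 < ∫ t in Ioi (0 : ℝ),
      -(Real.exp (-s * t) * (g (projIcc 0 1 zero_le_one (Real.exp (-t))) * f t)) := by
    refine (setIntegral_pos_iff_support_of_nonneg_ae ?_ hI.neg).2 ?_
    rotate_left
    · have hopen : IsOpen ({t : ℝ | |Real.exp (-t) - Real.exp (-t₀)| < δ} ∩ Ioi 0) :=
        (isOpen_lt (by fun_prop) continuous_const).inter isOpen_Ioi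
      refine (hopen.measure_pos volume ⟨t₀, by simpa using hδ, ht₀⟩).trans_le (measure_mono ?_)
      rintro t ⟨ht, ht0⟩
      refine ⟨?_, ht0⟩
      have h1 : 0 < max 0 (δ - |Real.exp (-t) - Real.exp (-t₀)|) :=
        lt_max_of_lt_right (sub_pos.2 ht)
      simp only [Function.mem_support, Pi.neg_apply, hgval t ht0]
      exact neg_ne_zero.2 (mul_ne_zero (Real.exp_pos _).ne' (mul_ne_zero h1.ne' (hfneg t ht).ne))
    · refine (ae_restrict_iff' measurableSet_Ioi).2 (Eventually.of_forall fun t ht => ?_)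
      simp only [Pi.neg_apply, hgval t ht, Pi.zero_apply, Left.nonneg_neg_iff]
      refine mul_nonpos_of_nonneg_of_nonpos (Real.exp_pos _).le ?_
      rcases lt_or_ge |Real.exp (-t) - Real.exp (-t₀)| δ with h | h
      · exact mul_nonpos_of_nonneg_of_nonpos (le_max_left _ _) (hfneg t h).le
      · rw [max_eq_left (sub_nonpos.2 h), zero_mul]
  rw [integral_neg] at hpos
  linarith

/-- A continuous function whose Laplace transform is completely monotone is nonnegative. -/
lemma nonneg_of_laplace_alternatingDerivs {f G : ℝ → ℝ} {c : ℝ} (hc : 0 ≤ c)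
    (hf : ContinuousOn f (Ioi 0)) (hG : ∀ m, AlternatingDerivs m G)
    (hint : ∀ s, c < s → IntegrableOn (fun t => Real.exp (-s * t) * f t) (Ioi 0))
    (hlap : ∀ s, c < s → laplace f s = G s) {t : ℝ} (ht : 0 < t) : 0 ≤ f t := by
  refine nonneg_of_laplace_moments_nonneg hf (hint (c + 1) (by linarith)) (fun k m => ?_) ht
  have := (hG m).laplace_one_sub_exp_pow_mul_nonneg hc hint hlap
    (s := c + 1 + k) (by linarith [k.cast_nonneg (α := ℝ)])
  refine this.trans_eq (setIntegral_congr_fun measurableSet_Ioi fun t _ => ?_)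
  simp only
  rw [← Real.exp_nat_mul, show -(c + 1 + k) * t = -(c + 1) * t + k * -t by ring, Real.exp_add]
  ring

lemma rpow_mul_exp_neg_le_mul_Gamma {a R : ℝ} (ha : 0 < a) (hR : 0 < R) :
    R ^ a * Real.exp (-R) ≤ a * Real.Gamma a := by
  rw [← Real.Gamma_add_one ha.ne', Real.Gamma_eq_integral (by linarith),
    ← integral_exp_neg_Ioi, ← integral_const_mul]
  have hconv : IntegrableOn (fun x => Real.exp (-x) * x ^ (a + 1 - 1)) (Ioi 0) :=
    Real.GammaIntegral_convergent (by linarith)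
  refine (setIntegral_mono_on ((integrableOn_exp_neg_Ioi R).const_mul _)
    (hconv.mono_set (Ioi_subset_Ioi hR.le)) measurableSet_Ioi fun x hx => ?_).trans
    (setIntegral_mono_set hconv ?_ (Ioi_subset_Ioi hR.le).eventuallyLE)
  · rw [add_sub_cancel_right, mul_comm]
    gcongr
    exact le_of_lt hx
  · refine (ae_restrict_iff' measurableSet_Ioi).2 (Eventually.of_forall fun x hx => ?_)
    have : (0 : ℝ) < x := hx
    simp only [Pi.zero_apply]
    positivity

lemma summable_rpow_div_Gamma {β a T : ℝ} (hβ : 0 < β) (ha : 0 < a) (hT : 0 < T) :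
    Summable fun n : ℕ => T ^ (β * n) / Real.Gamma (a + β * n) := by
  set R : ℝ := T * 2 ^ (1 / β) with hRdef
  have hR : 0 < R := by positivity
  have hratio : ∀ n : ℕ, T ^ (β * n) = R ^ (β * n) * (1 / 2 : ℝ) ^ n := by
    intro n
    rw [hRdef, Real.mul_rpow hT.le (by positivity), ← Real.rpow_mul (by norm_num),
      show 1 / β * (β * n) = n by field_simp, Real.rpow_natCast, mul_assoc, ← mul_pow]
    norm_num
  have hsum : Summable fun n : ℕ =>
      Real.exp R * R ^ (-a) * (a * (1 / 2 : ℝ) ^ n + β * (n ^ 1 * (1 / 2 : ℝ) ^ n)) :=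
    ((summable_geometric_two.mul_left a).add
      ((summable_pow_mul_geometric_of_norm_lt_one 1 (by norm_num)).mul_left β)).mul_left _
  refine hsum.of_nonneg_of_le (fun n => ?_) (fun n => ?_)
  · have : 0 < Real.Gamma (a + β * n) := Real.Gamma_pos_of_pos (by positivity)
    positivity
  · have hpos : 0 < a + β * n := by positivity
    rw [div_le_iff₀ (Real.Gamma_pos_of_pos hpos), hratio]
    have h := rpow_mul_exp_neg_le_mul_Gamma hpos hR
    calc R ^ (β * n) * (1 / 2 : ℝ) ^ n
        = (Real.exp R * R ^ (-a) * (1 / 2 : ℝ) ^ n) * (R ^ (a + β * n) * Real.exp (-R)) := by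
          rw [Real.rpow_add hR, Real.exp_neg, Real.rpow_neg hR.le]
          field_simp
      _ ≤ (Real.exp R * R ^ (-a) * (1 / 2 : ℝ) ^ n) *
            ((a + β * n) * Real.Gamma (a + β * n)) := by gcongr
      _ = _ := by ring

lemma integral_exp_neg_mul_rpow_div_Gamma {a s : ℝ} (ha : 0 < a) (hs : 0 < s) :
    ∫ t in Ioi (0 : ℝ), Real.exp (-s * t) * (t ^ (a - 1) / Real.Gamma a) = s ^ (-a) := by
  have h := Real.integral_rpow_mul_exp_neg_mul_Ioi ha hs
  have hΓ := (Real.Gamma_pos_of_pos ha).ne'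
  calc _ = ∫ t in Ioi (0 : ℝ), t ^ (a - 1) * Real.exp (-(s * t)) * (Real.Gamma a)⁻¹ := by
        refine setIntegral_congr_fun measurableSet_Ioi fun t _ => ?_
        simp only [neg_mul]
        ring
    _ = _ := by
        rw [integral_mul_const, h, mul_assoc, mul_inv_cancel₀ hΓ, mul_one, one_div,
          Real.inv_rpow hs.le, Real.rpow_neg hs.le]

/-- The two-parameter Mittag-Leffler kernel `t ^ (a - 1) * E_{β, a} (-t ^ β)`, expanded as a
series in real powers of `t`. -/
noncomputable def mittagLefflerKernel (β a t : ℝ) : ℝ :=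
  ∑' n : ℕ, (-1) ^ n * (t ^ (a + β * n - 1) / Real.Gamma (a + β * n))

lemma exists_summable_bound_kernel_terms {β a t : ℝ} (hβ : 0 < β) (ha : 0 < a) (ht : 0 < t) :
    ∃ u : ℕ → ℝ, Summable u ∧ ∀ n : ℕ, ∀ y ∈ Ioo (t / 2) (2 * t),
      ‖(-1) ^ n * (y ^ (a + β * n - 1) / Real.Gamma (a + β * n))‖ ≤ u n := by
  refine ⟨_, (summable_rpow_div_Gamma hβ ha (show 0 < 2 * t by positivity)).mul_left
    ((t / 2)⁻¹ * (2 * t) ^ a), fun n y hy => ?_⟩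
  have hy0 : 0 < y := (half_pos ht).trans hy.1
  have hΓ : 0 < Real.Gamma (a + β * n) := Real.Gamma_pos_of_pos (by positivity)
  rw [norm_mul, norm_pow, norm_neg, norm_one, one_pow, one_mul,
    Real.norm_of_nonneg (by positivity), mul_div_assoc', Real.rpow_sub_one hy0.ne',
    Real.rpow_add hy0, div_eq_inv_mul (y ^ a * _) y, mul_assoc]
  have := hy.1.le
  have := hy.2.le
  gcongr

lemma continuousOn_mittagLefflerKernel {β a : ℝ} (hβ : 0 < β) (ha : 0 < a) :
    ContinuousOn (mittagLefflerKernel β a) (Ioi 0) := by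
  intro t ht
  have ht : 0 < t := ht
  obtain ⟨u, hu, hbound⟩ := exists_summable_bound_kernel_terms hβ ha ht
  refine ContinuousAt.continuousWithinAt (ContinuousOn.continuousAt
    (continuousOn_tsum (fun n => ?_) hu hbound) (Ioo_mem_nhds (by linarith) (by linarith)))
  intro y hy
  have hy0 : y ≠ 0 := ((half_pos ht).trans hy.1).ne'
  exact (((Real.continuousAt_rpow_const y _ (Or.inl hy0)).div_const _).const_mul
    _).continuousWithinAt

lemma summable_mittagLefflerKernel {β a t : ℝ} (hβ : 0 < β) (ha : 0 < a) (ht : 0 < t) :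
    Summable fun n : ℕ => (-1) ^ n * (t ^ (a + β * n - 1) / Real.Gamma (a + β * n)) := by
  obtain ⟨u, hu, hbound⟩ := exists_summable_bound_kernel_terms hβ ha ht
  exact hu.of_norm_bounded fun n => hbound n t ⟨by linarith, by linarith⟩

lemma hasDerivAt_mittagLefflerKernel {β a t : ℝ} (hβ : 0 < β) (ha : 0 < a) (ht : 0 < t) :
    HasDerivAt (mittagLefflerKernel β (a + 1)) (mittagLefflerKernel β a t) t := by
  obtain ⟨u, hu, hbound⟩ := exists_summable_bound_kernel_terms hβ ha ht
  have hmem : t ∈ Ioo (t / 2) (2 * t) := ⟨by linarith, by linarith⟩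
  refine hasDerivAt_tsum_of_isPreconnected hu isOpen_Ioo isPreconnected_Ioo
    (fun n y hy => ?_) hbound hmem (summable_mittagLefflerKernel hβ (by linarith) ht) hmem
  have hy0 : y ≠ 0 := ((half_pos ht).trans hy.1).ne'
  have hpos : 0 < a + β * n := by positivity
  refine (((Real.hasDerivAt_rpow_const (p := a + 1 + β * n - 1)
    (Or.inl hy0)).div_const _).const_mul _).congr_deriv ?_
  rw [show a + 1 + β * n = a + β * n + 1 by ring, add_sub_cancel_right,
    Real.Gamma_add_one hpos.ne', mul_div_mul_left _ _ hpos.ne']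

lemma mittagLefflerKernel_one_eq {β t : ℝ} (hβ : 0 < β) (ht : 0 < t) :
    mittagLefflerKernel β 1 t = 1 - mittagLefflerKernel β (β + 1) t := by
  rw [mittagLefflerKernel, (summable_mittagLefflerKernel hβ one_pos ht).tsum_eq_zero_add,
    mittagLefflerKernel, sub_eq_add_neg 1, ← tsum_neg]
  congr 1
  · simp
  · refine tsum_congr fun n => ?_
    push_cast
    rw [show 1 + β * (n + 1) = β + 1 + β * n by ring, pow_succ]
    ring

lemma hasDerivAt_mittagLefflerKernel_one {β t : ℝ} (hβ : 0 < β) (ht : 0 < t) :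
    HasDerivAt (mittagLefflerKernel β 1) (-mittagLefflerKernel β β t) t :=
  ((hasDerivAt_mittagLefflerKernel hβ hβ ht).const_sub 1).congr_of_eventuallyEq
    ((eventually_gt_nhds ht).mono fun _ hy => mittagLefflerKernel_one_eq hβ hy)

lemma mittagLeffler_neg_rpow {β t : ℝ} (ht : 0 < t) :
    mittagLeffler β (-(t ^ β)) = mittagLefflerKernel β 1 t := by
  refine tsum_congr fun n => ?_
  rw [neg_pow, ← Real.rpow_natCast (t ^ β), ← Real.rpow_mul ht.le, add_sub_cancel_left,
    add_comm (β * n) 1, mul_div_assoc]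

lemma integrableOn_and_laplace_mittagLefflerKernel {β a s : ℝ} (hβ : 0 < β) (ha : 0 < a)
    (hs : 1 < s) :
    IntegrableOn (fun t => Real.exp (-s * t) * mittagLefflerKernel β a t) (Ioi 0) ∧
      laplace (mittagLefflerKernel β a) s = s ^ (β - a) * (1 / (1 + s ^ β)) := by
  have hs0 : 0 < s := one_pos.trans hs
  have hpos : ∀ n : ℕ, 0 < a + β * n := fun n => by positivity
  let P : ℕ → ℝ → ℝ := fun n t =>
    Real.exp (-s * t) * (t ^ (a + β * n - 1) / Real.Gamma (a + β * n))
  have hPint : ∀ n, ∫ t in Ioi (0 : ℝ), P n t = s ^ (-(a + β * n)) := fun n =>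
    integral_exp_neg_mul_rpow_div_Gamma (hpos n) hs0
  have hPI : ∀ n, IntegrableOn (P n) (Ioi 0) := fun n =>
    Integrable.of_integral_ne_zero (by rw [hPint]; positivity)
  have hPnonneg : ∀ n t, 0 < t → 0 ≤ P n t := fun n t ht => by
    have := Real.Gamma_pos_of_pos (hpos n)
    positivity
  have hPnorm : ∀ n, ∫ t in Ioi (0 : ℝ), ‖P n t‖ = s ^ (-(a + β * n)) := fun n => by
    rw [← hPint]
    exact setIntegral_congr_fun measurableSet_Ioi fun t ht =>
      Real.norm_of_nonneg (hPnonneg n t ht)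
  have hgeom : ∀ n : ℕ, s ^ (-(a + β * n)) = s ^ (-a) * (s ^ (-β)) ^ n := fun n => by
    rw [neg_add, Real.rpow_add hs0, ← Real.rpow_natCast, ← Real.rpow_mul hs0.le, neg_mul]
  have hq0 : 0 < s ^ (-β) := by positivity
  have hq1 : s ^ (-β) < 1 := Real.rpow_lt_one_of_one_lt_of_neg hs (by linarith)
  have hsumm : Summable fun n : ℕ => s ^ (-(a + β * n)) := by
    simp only [hgeom]
    exact (summable_geometric_of_lt_one hq0.le hq1).mul_left _
  have hdom : IntegrableOn (fun t => ∑' n, P n t) (Ioi 0) := by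
    have h := hasSum_integral_of_summable_integral_norm hPI (by simpa only [hPnorm] using hsumm)
    refine Integrable.of_integral_ne_zero ?_
    rw [← h.tsum_eq]
    simp only [hPint]
    exact (hsumm.tsum_pos (fun n => by positivity) 0 (by positivity)).ne'
  have hsummP : ∀ t, 0 < t → Summable fun n => P n t := fun t ht => by
    refine ((summable_mittagLefflerKernel hβ ha ht).norm.congr fun n => ?_).mul_left
      (Real.exp (-s * t))
    have := Real.Gamma_pos_of_pos (hpos n)
    rw [norm_mul, norm_pow, norm_neg, norm_one, one_pow, one_mul,
      Real.norm_of_nonneg (by positivity)]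
  have hseries : ∀ t, Real.exp (-s * t) * mittagLefflerKernel β a t =
      ∑' n, (-1) ^ n * P n t := fun t => by
    rw [mittagLefflerKernel, ← tsum_mul_left]
    exact tsum_congr fun n => by simp only [P]; ring
  constructor
  · refine hdom.mono' (ContinuousOn.aestronglyMeasurable ((by fun_prop : Continuous
      fun t => Real.exp (-s * t)).continuousOn.mul (continuousOn_mittagLefflerKernel hβ ha))
      measurableSet_Ioi) ((ae_restrict_iff' measurableSet_Ioi).2 (Eventually.of_forall
        fun t ht => ?_))
    have hnorm : ∀ n, ‖(-1) ^ n * P n t‖ = P n t := fun n => by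
      rw [norm_mul, norm_pow, norm_neg, norm_one, one_pow, one_mul,
        Real.norm_of_nonneg (hPnonneg n t ht)]
    rw [hseries]
    refine (norm_tsum_le_tsum_norm (by simpa only [hnorm] using hsummP t ht)).trans_eq ?_
    simp only [hnorm]
  · have h := hasSum_integral_of_summable_integral_norm (μ := volume.restrict (Ioi 0))
      (F := fun n t => (-1) ^ n * P n t) (fun n => (hPI n).const_mul _)
      (by simpa only [norm_mul, norm_pow, norm_neg, norm_one, one_pow, one_mul, hPnorm]
        using hsumm)
    simp only [integral_const_mul, hPint, hgeom] at h
    have hgs := (hasSum_geometric_of_abs_lt_one (r := -s ^ (-β))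
      (by rwa [abs_neg, abs_of_pos hq0])).mul_left (s ^ (-a))
    simp only [laplace, hseries]
    rw [h.unique (hgs.congr_fun fun n => by rw [neg_pow]; ring), Real.rpow_sub hs0,
      Real.rpow_neg hs0.le, Real.rpow_neg hs0.le]
    have : 0 < s ^ β := by positivity
    field_simp
    rw [sub_neg_eq_add, add_comm, div_self (by positivity)]

lemma mittagLefflerKernel_nonneg {β a t : ℝ} (hβ0 : 0 < β) (hβ1 : β ≤ 1) (ha : β ≤ a)
    (ht : 0 < t) : 0 ≤ mittagLefflerKernel β a t := by
  have ha0 : 0 < a := hβ0.trans_le ha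
  refine nonneg_of_laplace_alternatingDerivs zero_le_one
    (continuousOn_mittagLefflerKernel hβ0 ha0)
    (fun m => (AlternatingDerivs.rpow_neg m (sub_nonneg.2 ha)).mul
      (AlternatingDerivs.inv_one_add_rpow m hβ0 hβ1))
    (fun s hs => (integrableOn_and_laplace_mittagLefflerKernel hβ0 ha0 hs).1)
    (fun s hs => ?_) ht
  rw [(integrableOn_and_laplace_mittagLefflerKernel hβ0 ha0 hs).2, neg_sub]

lemma integrableOn_mittagLefflerKernel {β : ℝ} (hβ0 : 0 < β) (hβ1 : β ≤ 1) :
    IntegrableOn (mittagLefflerKernel β β) (Ioi 0) := by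
  have hcont := continuousOn_mittagLefflerKernel hβ0 hβ0
  rw [← Ioc_union_Ioi_eq_Ioi zero_le_one]
  refine IntegrableOn.union ?_ ?_
  · have h := (integrableOn_and_laplace_mittagLefflerKernel hβ0 hβ0 one_lt_two).1.mono_set
      (Ioc_subset_Ioi_self : Ioc (0 : ℝ) 1 ⊆ Ioi 0)
    refine (h.const_mul (Real.exp 2)).mono' ((hcont.mono Ioc_subset_Ioi_self).aestronglyMeasurable
      measurableSet_Ioc) ((ae_restrict_iff' measurableSet_Ioc).2 (Eventually.of_forall
        fun t ht => ?_))
    have h0 := mittagLefflerKernel_nonneg hβ0 hβ1 le_rfl ht.1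
    rw [Real.norm_of_nonneg h0, ← mul_assoc, ← Real.exp_add]
    exact le_mul_of_one_le_left h0 (Real.one_le_exp (by linarith [ht.2]))
  · have hderiv : ∀ x ∈ Ici (1 : ℝ),
        HasDerivAt (mittagLefflerKernel β 1) (-mittagLefflerKernel β β x) x := fun x hx =>
      hasDerivAt_mittagLefflerKernel_one hβ0 (one_pos.trans_le hx)
    have hnonpos : ∀ x ∈ Ioi (1 : ℝ), -mittagLefflerKernel β β x ≤ 0 := fun x hx =>
      neg_nonpos.2 (mittagLefflerKernel_nonneg hβ0 hβ1 le_rfl (one_pos.trans hx))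
    have hanti : AntitoneOn (mittagLefflerKernel β 1) (Ici 1) := by
      refine antitoneOn_of_deriv_nonpos (convex_Ici 1)
        (fun x hx => (hderiv x hx).continuousAt.continuousWithinAt)
        (fun x hx => ?_) (fun x hx => ?_) <;> rw [interior_Ici] at hx
      · exact (hderiv x (mem_Ici.2 (le_of_lt hx))).differentiableAt.differentiableWithinAt
      · rw [(hderiv x (mem_Ici.2 (le_of_lt hx))).deriv]
        exact hnonpos x hx
    have hanti' : Antitone fun x => mittagLefflerKernel β 1 (max 1 x) := fun x y hxy =>
      hanti (mem_Ici.2 (le_max_left _ _)) (mem_Ici.2 (le_max_left _ _)) (max_le_max_left 1 hxy)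
    have hlim := tendsto_atTop_ciInf hanti' ⟨0, by
      rintro _ ⟨x, rfl⟩
      exact mittagLefflerKernel_nonneg hβ0 hβ1 hβ1 (one_pos.trans_le (le_max_left _ _))⟩
    have hlim' := hlim.congr' (f₂ := mittagLefflerKernel β 1)
      ((eventually_ge_atTop 1).mono fun x hx => by rw [max_eq_right hx])
    simpa using (integrableOn_Ioi_deriv_of_nonpos' hderiv hnonpos hlim').neg

/-- The Laplace transform of an integrable nonnegative function is real analytic on `(0, ∞)`. -/
lemma analyticOnNhd_laplace {f : ℝ → ℝ} (hf : IntegrableOn f (Ioi 0))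
    (hf0 : ∀ t, 0 < t → 0 ≤ f t) : AnalyticOnNhd ℝ (laplace f) (Ioi 0) := by
  set ρ : ℝ → ENNReal := fun t => ENNReal.ofReal (f t)
  set μ : Measure ℝ := (volume.restrict (Ioi 0)).withDensity ρ
  have hρ : AEMeasurable ρ (volume.restrict (Ioi 0)) := hf.aemeasurable.ennreal_ofReal
  have hρ_top : ∀ᵐ t ∂volume.restrict (Ioi (0 : ℝ)), ρ t < ⊤ :=
    Eventually.of_forall fun _ => ENNReal.ofReal_lt_top
  have hmgf : laplace f = ProbabilityTheory.mgf (fun t => -t) μ := by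
    ext s
    rw [ProbabilityTheory.mgf, integral_withDensity_eq_integral_toReal_smul₀ hρ hρ_top, laplace]
    refine setIntegral_congr_fun measurableSet_Ioi fun t ht => ?_
    simp only [ρ, ENNReal.toReal_ofReal (hf0 t ht), smul_eq_mul, mul_neg, mul_comm]
  have hsub : Ioi 0 ⊆ ProbabilityTheory.integrableExpSet (fun t => -t) μ := by
    intro s hs
    refine (integrable_withDensity_iff_integrable_smul₀' hρ hρ_top).2 ?_
    have hint : IntegrableOn (fun t => Real.exp (s * -t) * f t) (Ioi 0) := by
      refine Integrable.bdd_mul hf (c := 1) (by fun_prop)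
        ((ae_restrict_iff' measurableSet_Ioi).2 (Eventually.of_forall fun t ht => ?_))
      rw [Real.norm_of_nonneg (Real.exp_pos _).le, Real.exp_le_one_iff]
      have := mul_pos (mem_Ioi.1 hs) (mem_Ioi.1 ht)
      linarith
    refine hint.congr_fun (fun t ht => ?_) measurableSet_Ioi
    simp only [ρ, ENNReal.toReal_ofReal (hf0 t ht), smul_eq_mul, mul_comm]
  rw [hmgf]
  exact ProbabilityTheory.analyticOnNhd_mgf.mono (interior_maximal hsub isOpen_Ioi)

lemma analyticOnNhd_inv_one_add_rpow (β : ℝ) :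
    AnalyticOnNhd ℝ (fun s : ℝ => 1 / (1 + s ^ β)) (Ioi 0) := by
  intro s hs
  have hs : 0 < s := hs
  have hrpow : AnalyticAt ℝ (fun x : ℝ => x ^ β) s := by
    refine ((analyticAt_id.log hs).mul (analyticAt_const (v := β))).rexp'.congr ?_
    exact (eventually_gt_nhds hs).mono fun x hx => (Real.rpow_def_of_pos hx β).symm
  exact analyticAt_const.div (analyticAt_const.add hrpow) (by positivity)

theorem mittagLeffler_density_laplace (β : ℝ) (hβ0 : 0 < β) (hβ1 : β ≤ 1)
    (s : ℝ) (hs : 0 < s) :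
    laplace (fun t => -deriv (fun u => mittagLeffler β (-(u ^ β))) t) s
      = 1 / (1 + s ^ β) := by
  have hdensity : laplace (fun t => -deriv (fun u => mittagLeffler β (-(u ^ β))) t) s =
      laplace (mittagLefflerKernel β β) s := by
    refine setIntegral_congr_fun measurableSet_Ioi fun t ht => ?_
    have h := (hasDerivAt_mittagLefflerKernel_one hβ0 ht).congr_of_eventuallyEq
      ((eventually_gt_nhds ht).mono fun _ hy => mittagLeffler_neg_rpow (β := β) hy)
    simp only [h.deriv, neg_neg]
  rw [hdensity]
  refine (analyticOnNhd_laplace (integrableOn_mittagLefflerKernel hβ0 hβ1)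
    fun t ht => mittagLefflerKernel_nonneg hβ0 hβ1 le_rfl ht).eqOn_of_preconnected_of_eventuallyEq
    (analyticOnNhd_inv_one_add_rpow β) isPreconnected_Ioi (mem_Ioi.2 two_pos) ?_ hs
  filter_upwards [eventually_gt_nhds one_lt_two] with x hx
  simpa using (integrableOn_and_laplace_mittagLefflerKernel hβ0 hβ0 hx).2
end

section
/- For 0 < β < 1 the function Ψ(t) = E_β(-t^β) has the asymptotic behavior Ψ(t) ~ sin(βπ)/π · Γ(β)/t^β as t → ∞, i.e. t^β E_β(-t^β) → sin(βπ)Γ(β)/π. -/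
open Filter

open MeasureTheory Set Complex
open scoped Real Topology

/-- The part of a Hankel-type integral of `F` along the boundary of the half-strip
`{w | c ≤ re w, |im w| ≤ π}`, the two horizontal rays being combined into one integral. -/
noncomputable def hankelIntegral (F : ℂ → ℂ) (c : ℝ) : ℂ :=
  (∫ y in Ioi c, (F (y + π * I) - F (y + (-π : ℝ) * I))) +
    I * ∫ θ in (-π)..π, F (c + θ * I)

/-- Hankel integrals of holomorphic functions on the strip `|im w| ≤ π` do not depend on the
abscissa of the vertical side. -/
theorem hankelIntegral_eq_of_differentiableOn {F : ℂ → ℂ}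
    (hF : DifferentiableOn ℂ F {w | |w.im| ≤ π})
    (hD : ∀ c : ℝ, IntegrableOn
      (fun y : ℝ => F (y + π * I) - F (y + (-π : ℝ) * I)) (Ioi c)) (c d : ℝ) :
    hankelIntegral F c = hankelIntegral F d := by
  have key := Complex.integral_boundary_rect_eq_zero_of_differentiableOn F
    (c + (-π : ℝ) * I) (d + π * I) (hF.mono (by
      intro w hw
      have h2 := hw.2
      simp only [mem_preimage, add_im, ofReal_im, mul_im, ofReal_re, I_im, mul_one, I_re,
        mul_zero, add_zero, zero_add] at h2
      rw [uIcc_of_le (by linarith [Real.pi_pos])] at h2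
      exact abs_le.2 h2))
  have hline : ∀ b : ℝ, |b| ≤ π → Continuous (fun y : ℝ => F (y + b * I)) := by
    intro b hb
    refine hF.continuousOn.comp_continuous (by fun_prop) fun y => ?_
    simpa using hb
  have h1 := hline π (abs_of_pos Real.pi_pos).le
  have h2 := hline (-π) (by rw [abs_neg, abs_of_pos Real.pi_pos])
  simp only [add_im, ofReal_im, mul_im, ofReal_re, I_im, mul_one, I_re, add_re, mul_re,
        mul_zero, add_zero, zero_add, sub_zero, smul_eq_mul] at key
  have h3 := intervalIntegral.integral_interval_add_Ioi (hD c) (hD d)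
  rw [intervalIntegral.integral_sub (h1.intervalIntegrable _ _)
    (h2.intervalIntegrable _ _)] at h3
  unfold hankelIntegral
  rw [← h3]
  linear_combination (-1 : ℂ) * key

/-- If `F` decays at the left end of the strip, then its Hankel integral is the integral of its
jump across the whole line. -/
theorem hankelIntegral_eq_integral {F : ℂ → ℂ}
    (hF : DifferentiableOn ℂ F {w | |w.im| ≤ π})
    (hD : Integrable (fun y : ℝ => F (y + π * I) - F (y + (-π : ℝ) * I)))
    {g : ℝ → ℝ} (hg : Tendsto g atBot (𝓝 0))
    (hFg : ∀ᶠ c : ℝ in atBot, ∀ θ : ℝ, |θ| ≤ π → ‖F (c + θ * I)‖ ≤ g c) (c : ℝ) :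
    hankelIntegral F c = ∫ y : ℝ, (F (y + π * I) - F (y + (-π : ℝ) * I)) := by
  have h1 : Tendsto (hankelIntegral F) atBot (𝓝 (hankelIntegral F c)) := by
    refine tendsto_const_nhds.congr fun d => ?_
    exact hankelIntegral_eq_of_differentiableOn hF (fun _ => hD.integrableOn) c d
  have h2 := (aecover_Ioi (μ := (volume : Measure ℝ))
    (tendsto_id (α := ℝ) (x := atBot))).integral_tendsto_of_countably_generated hD
  have h3 : Tendsto (fun c : ℝ => ∫ θ in (-π)..π, F (c + θ * I)) atBot (𝓝 0) := by
    have h4 : Tendsto (fun c => g c * |π - -π|) atBot (𝓝 0) := by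
      simpa using hg.mul_const |π - -π|
    refine squeeze_zero_norm' ?_ h4
    filter_upwards [hFg] with c hc
    refine intervalIntegral.norm_integral_le_of_norm_le_const fun θ hθ => hc θ ?_
    rw [uIoc_of_le (by linarith [Real.pi_pos])] at hθ
    exact abs_le.2 ⟨hθ.1.le, hθ.2⟩
  have h5 := h2.add (h3.const_mul I)
  rw [mul_zero, add_zero] at h5
  exact tendsto_nhds_unique h1 h5

theorem exp_ofReal_add_pi_mul_I (y : ℝ) : cexp (y + π * I) = ((-Real.exp y : ℝ) : ℂ) := by
  rw [Complex.exp_add, Complex.exp_pi_mul_I]; push_cast; ring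

theorem exp_ofReal_add_neg_pi_mul_I (y : ℝ) :
    cexp (y + (-π : ℝ) * I) = ((-Real.exp y : ℝ) : ℂ) := by
  rw [Complex.exp_add, ofReal_neg, neg_mul, Complex.exp_neg_pi_mul_I]; push_cast; ring

theorem norm_exp_exp_sub (a : ℝ) (w : ℂ) :
    ‖cexp (cexp w - a * w)‖ = Real.exp (Real.exp w.re * Real.cos w.im - a * w.re) := by
  rw [Complex.norm_exp]; simp [Complex.exp_re]

theorem integrable_exp_neg_exp_add_mul {b : ℝ} (hb : 0 < b) :
    Integrable (fun y : ℝ => Real.exp (-Real.exp y + b * y)) := by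
  have h := integrableOn_image_iff_integrableOn_abs_deriv_smul (s := univ) (f := Real.exp)
    (f' := Real.exp) MeasurableSet.univ (fun x _ => (Real.hasDerivAt_exp x).hasDerivWithinAt)
    Real.exp_injective.injOn (fun x => Real.exp (-x) * x ^ (b - 1))
  rw [image_univ, Real.range_exp] at h
  rw [← integrableOn_univ]
  refine (h.1 (Real.GammaIntegral_convergent hb)).congr_fun (fun y _ => ?_) MeasurableSet.univ
  simp only [smul_eq_mul, abs_of_pos (Real.exp_pos y), ← Real.exp_mul, ← Real.exp_add]
  congr 1; ring

theorem integral_exp_neg_exp_add_mul {b : ℝ} (hb : 0 < b) :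
    ∫ y : ℝ, Real.exp (-Real.exp y + b * y) = Real.Gamma b := by
  have h := integral_image_eq_integral_abs_deriv_smul (s := univ) (f := Real.exp)
    (f' := Real.exp) MeasurableSet.univ (fun x _ => (Real.hasDerivAt_exp x).hasDerivWithinAt)
    Real.exp_injective.injOn (fun x => Real.exp (-x) * x ^ (b - 1))
  rw [image_univ, Real.range_exp, setIntegral_univ] at h
  rw [Real.Gamma_eq_integral hb, h]
  refine integral_congr_ae (.of_forall fun y => ?_)
  simp only [smul_eq_mul, abs_of_pos (Real.exp_pos y), ← Real.exp_mul, ← Real.exp_add]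
  congr 1; ring

theorem integrableOn_exp_neg_exp_add_mul (b c : ℝ) :
    IntegrableOn (fun y : ℝ => Real.exp (-Real.exp y + b * y)) (Ioi c) := by
  have hpos : 0 < |b| + 1 := by positivity
  refine Integrable.mono'
    (((integrable_exp_neg_exp_add_mul hpos).const_mul
      (Real.exp ((b - (|b| + 1)) * c))).integrableOn) (by fun_prop) ?_
  refine (ae_restrict_mem measurableSet_Ioi).mono fun y hy => ?_
  rw [Real.norm_of_nonneg (Real.exp_pos _).le, ← Real.exp_add]
  refine Real.exp_le_exp.2 ?_
  have : b - (|b| + 1) ≤ 0 := by linarith [le_abs_self b]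
  nlinarith [mem_Ioi.1 hy]

theorem norm_exp_exp_sub_add_pi_mul_I (a y : ℝ) :
    ‖cexp (cexp (y + π * I) - a * (y + π * I))‖ = Real.exp (-Real.exp y + -a * y) := by
  rw [norm_exp_exp_sub]; simp [sub_eq_add_neg]

theorem norm_exp_exp_sub_add_neg_pi_mul_I (a y : ℝ) :
    ‖cexp (cexp (y + (-π : ℝ) * I) - a * (y + (-π : ℝ) * I))‖ =
      Real.exp (-Real.exp y + -a * y) := by
  rw [norm_exp_exp_sub]; simp [sub_eq_add_neg]

theorem integrableOn_exp_exp_sub_add_pi_mul_I (a c : ℝ) :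
    IntegrableOn (fun y : ℝ => cexp (cexp (y + π * I) - a * (y + π * I))) (Ioi c) :=
  (integrableOn_exp_neg_exp_add_mul (-a) c).mono' (by fun_prop)
    (.of_forall fun y => (norm_exp_exp_sub_add_pi_mul_I a y).le)

theorem integrableOn_exp_exp_sub_add_neg_pi_mul_I (a c : ℝ) :
    IntegrableOn (fun y : ℝ => cexp (cexp (y + (-π : ℝ) * I) - a * (y + (-π : ℝ) * I)))
      (Ioi c) :=
  (integrableOn_exp_neg_exp_add_mul (-a) c).mono' (by fun_prop)
    (.of_forall fun y => (norm_exp_exp_sub_add_neg_pi_mul_I a y).le)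

/-- Hankel's formula for negative parameters, from Euler's integral and reflection. -/
theorem hankelIntegral_exp_exp_sub_of_neg {a : ℝ} (ha : a < 0) (ha1 : -1 < a) (c : ℝ) :
    hankelIntegral (fun w => cexp (cexp w - a * w)) c =
      2 * π * I / (Real.Gamma (a + 1) : ℂ) := by
  have hb : 0 < -a := by linarith
  have hjump : ∀ y : ℝ, cexp (cexp (y + π * I) - a * (y + π * I)) -
      cexp (cexp (y + (-π : ℝ) * I) - a * (y + (-π : ℝ) * I)) =
      (2 * I * (Real.sin (π * -a) : ℂ)) * (Real.exp (-Real.exp y + -a * y) : ℂ) := by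
    intro y
    rw [exp_ofReal_add_pi_mul_I, exp_ofReal_add_neg_pi_mul_I]
    have e1 : ((-Real.exp y : ℝ) : ℂ) - a * (y + π * I) =
      ((-Real.exp y + -a * y : ℝ) : ℂ) + (π * -a : ℂ) * I := by push_cast; ring
    have e2 : ((-Real.exp y : ℝ) : ℂ) - a * (y + (-π : ℝ) * I) =
      ((-Real.exp y + -a * y : ℝ) : ℂ) + -(π * -a : ℂ) * I := by push_cast; ring
    rw [e1, e2, Complex.exp_add, Complex.exp_add, ← ofReal_exp, ofReal_sin]
    have := Complex.two_sin (π * -a)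
    push_cast at this ⊢
    linear_combination (-I * (cexp (-cexp y + -a * y))) * this
      + (cexp (-cexp y + -a * y)) * (cexp (π * -a * I) - cexp (-(π * -a) * I)) * I_sq
  rw [hankelIntegral_eq_integral (g := fun c => Real.exp (1 + -a * c))]
  · simp only [hjump]
    rw [integral_const_mul, integral_complex_ofReal, integral_exp_neg_exp_add_mul hb]
    have hrefl := Real.Gamma_mul_Gamma_one_sub (-a)
    rw [show 1 - -a = a + 1 by ring] at hrefl
    have hs : Real.sin (π * -a) ≠ 0 :=
      (Real.sin_pos_of_pos_of_lt_pi (by positivity) (by nlinarith [Real.pi_pos])).ne'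
    have hG : Real.Gamma (a + 1) ≠ 0 := (Real.Gamma_pos_of_pos (by linarith)).ne'
    rw [eq_div_iff hs] at hrefl
    rw [eq_div_iff (ofReal_ne_zero.2 hG)]
    have := congrArg (fun x : ℝ => (x : ℂ)) hrefl
    push_cast at this ⊢
    linear_combination (2 * I) * this
  · exact Differentiable.differentiableOn (by fun_prop)
  · simp only [hjump]
    exact (integrable_exp_neg_exp_add_mul hb).ofReal.const_mul _
  · refine Real.tendsto_exp_atBot.comp (tendsto_atBot_add_const_left _ _ ?_)
    exact tendsto_id.const_mul_atBot hb
  · filter_upwards [eventually_le_atBot 0] with c hc θ _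
    rw [norm_exp_exp_sub]
    refine Real.exp_le_exp.2 ?_
    have h1 : Real.exp c ≤ 1 := Real.exp_le_one_iff.2 hc
    have h2 := Real.cos_le_one θ
    have h3 := Real.exp_pos c
    simp
    nlinarith

theorem tendsto_exp_neg_exp_add_mul_atTop (b : ℝ) :
    Tendsto (fun y : ℝ => Real.exp (-Real.exp y + b * y)) atTop (𝓝 0) := by
  refine ((tendsto_rpow_mul_exp_neg_mul_atTop_nhds_zero b 1 one_pos).comp
    Real.tendsto_exp_atTop).congr fun y => ?_
  simp only [Function.comp, ← Real.exp_mul, ← Real.exp_add]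
  congr 1; ring

theorem hankelIntegral_exp_exp_sub_one (a c : ℝ) :
    hankelIntegral (fun w => cexp (cexp w - (a - 1 : ℝ) * w)) c =
      a * hankelIntegral (fun w => cexp (cexp w - a * w)) c := by
  set G : ℂ → ℂ := fun w => cexp (cexp w - a * w) with hG
  have hsplit : ∀ w, cexp (cexp w - (a - 1 : ℝ) * w) = (cexp w - a) * G w + a * G w := by
    intro w
    have : cexp w - (a - 1 : ℝ) * w = (cexp w - a * w) + w := by push_cast; ring
    rw [this, Complex.exp_add]; ring
  have hderiv : ∀ w, HasDerivAt G ((cexp w - a) * G w) w := by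
    intro w
    have := ((Complex.hasDerivAt_exp w).sub ((hasDerivAt_id w).const_mul (a : ℂ))).cexp
    exact this.congr_deriv (by simp [hG]; ring)
  have hH : ∀ b y : ℝ, HasDerivAt (fun y : ℝ => G (y + b * I))
      ((cexp (y + b * I) - a) * G (y + b * I)) y := fun b y =>
    ((hderiv (y + b * I)).comp_add_const (y : ℂ) (b * I)).comp_ofReal
  have hV : ∀ θ : ℝ, HasDerivAt (fun θ : ℝ => G (c + θ * I))
      ((cexp (c + θ * I) - a) * G (c + θ * I) * I) θ := by
    intro θ
    have h := (hderiv (c + θ * I)).comp (θ : ℂ)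
      (((hasDerivAt_id (θ : ℂ)).mul_const I).const_add (c : ℂ))
    rw [one_mul] at h
    exact h.comp_ofReal
  have hup : IntegrableOn (fun y : ℝ => G (y + π * I)) (Ioi c) :=
    integrableOn_exp_exp_sub_add_pi_mul_I a c
  have hlo : IntegrableOn (fun y : ℝ => G (y + (-π : ℝ) * I)) (Ioi c) :=
    integrableOn_exp_exp_sub_add_neg_pi_mul_I a c
  have hup' : IntegrableOn (fun y : ℝ => (cexp (y + π * I) - a) * G (y + π * I)) (Ioi c) := by
    refine ((integrableOn_exp_exp_sub_add_pi_mul_I (a - 1) c).sub (hup.const_mul (a : ℂ))).congr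
      (.of_forall fun y => ?_)
    simp only [Pi.sub_apply, hsplit]; ring
  have hlo' : IntegrableOn
      (fun y : ℝ => (cexp (y + (-π : ℝ) * I) - a) * G (y + (-π : ℝ) * I)) (Ioi c) := by
    refine ((integrableOn_exp_exp_sub_add_neg_pi_mul_I (a - 1) c).sub
      (hlo.const_mul (a : ℂ))).congr (.of_forall fun y => ?_)
    simp only [Pi.sub_apply, hsplit]; ring
  have hlimup : Tendsto (fun y : ℝ => G (y + π * I)) atTop (𝓝 0) := by
    refine squeeze_zero_norm (fun y => ?_) (tendsto_exp_neg_exp_add_mul_atTop (-a))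
    exact (norm_exp_exp_sub_add_pi_mul_I a y).le
  have hlimlo : Tendsto (fun y : ℝ => G (y + (-π : ℝ) * I)) atTop (𝓝 0) := by
    refine squeeze_zero_norm (fun y => ?_) (tendsto_exp_neg_exp_add_mul_atTop (-a))
    exact (norm_exp_exp_sub_add_neg_pi_mul_I a y).le
  have i1 := integral_Ioi_of_hasDerivAt_of_tendsto (hH π c).continuousAt.continuousWithinAt
    (fun y _ => hH π y) hup' hlimup
  have i2 := integral_Ioi_of_hasDerivAt_of_tendsto (hH (-π) c).continuousAt.continuousWithinAt
    (fun y _ => hH (-π) y) hlo' hlimlo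
  have hcG : Continuous G := by fun_prop
  have i3 := intervalIntegral.integral_eq_sub_of_hasDerivAt (a := -π) (b := π)
    (fun θ _ => hV θ) (Continuous.intervalIntegrable (by fun_prop) _ _)
  rw [intervalIntegral.integral_mul_const] at i3
  have j1 : ∫ y in Ioi c, (cexp (cexp (y + π * I) - (a - 1 : ℝ) * (y + π * I)) -
      cexp (cexp (y + (-π : ℝ) * I) - (a - 1 : ℝ) * (y + (-π : ℝ) * I))) =
      (∫ y in Ioi c, (cexp (y + π * I) - a) * G (y + π * I)) -
      (∫ y in Ioi c, (cexp (y + (-π : ℝ) * I) - a) * G (y + (-π : ℝ) * I)) +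
      a * ∫ y in Ioi c, (G (y + π * I) - G (y + (-π : ℝ) * I)) := by
    have hadd := integral_add (hup'.sub hlo') ((hup.sub hlo).const_mul (a : ℂ))
    simp only [Pi.sub_apply] at hadd
    rw [← integral_sub hup' hlo', ← integral_const_mul, ← hadd]
    refine integral_congr_ae (.of_forall fun y => ?_)
    simp only [hsplit]; ring
  have j2 : ∫ θ in (-π)..π, cexp (cexp (c + θ * I) - (a - 1 : ℝ) * (c + θ * I)) =
      (∫ θ in (-π)..π, (cexp (c + θ * I) - a) * G (c + θ * I)) +
      a * ∫ θ in (-π)..π, G (c + θ * I) := by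
    rw [← intervalIntegral.integral_const_mul, ← intervalIntegral.integral_add
      (Continuous.intervalIntegrable (by fun_prop) _ _)
      (Continuous.intervalIntegrable (by fun_prop) _ _)]
    simp only [hsplit]
  unfold hankelIntegral
  rw [j1, j2, i1, i2]
  linear_combination i3

theorem hankelIntegral_exp_exp (c : ℝ) :
    hankelIntegral (fun w => cexp (cexp w)) c = 2 * π * I := by
  have h1 : ∫ θ in (-π)..π, cexp (cexp (c + θ * I)) = 2 * π := by
    have hper : Function.Periodic (fun θ : ℝ => cexp (cexp (c + θ * I))) (2 * π) := by
      intro θ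
      have : (c : ℂ) + ((θ + 2 * π : ℝ) : ℂ) * I = (c + θ * I) + 2 * π * I := by
        push_cast; ring
      simp only [this, Complex.exp_periodic _]
    have h2 := hper.intervalIntegral_add_eq (-π) 0
    rw [show -π + 2 * π = π by ring, zero_add] at h2
    have h3 := (Complex.differentiable_exp.diffContOnCl
      (s := Metric.ball 0 (Real.exp c))).circleIntegral_sub_inv_smul
      (Metric.mem_ball_self (Real.exp_pos c))
    rw [circleIntegral] at h3
    have h4 : ∀ θ : ℝ, deriv (circleMap 0 (Real.exp c)) θ •
        (circleMap 0 (Real.exp c) θ - 0)⁻¹ • cexp (circleMap 0 (Real.exp c) θ) =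
        I * cexp (cexp (c + θ * I)) := by
      intro θ
      have hne : circleMap 0 (Real.exp c) θ ≠ 0 := circleMap_ne_center (Real.exp_pos c).ne'
      have he : cexp (c + θ * I) = circleMap 0 (Real.exp c) θ := by
        simp [circleMap, Complex.exp_add]
      rw [he, deriv_circleMap]
      simp only [smul_eq_mul, sub_zero]
      field_simp
    simp only [h4] at h3
    rw [intervalIntegral.integral_const_mul, ← h2] at h3
    simp only [Complex.exp_zero, smul_eq_mul, mul_one] at h3
    exact mul_left_cancel₀ I_ne_zero (by linear_combination h3)
  unfold hankelIntegral
  rw [h1]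
  simp only [exp_ofReal_add_pi_mul_I, exp_ofReal_add_neg_pi_mul_I, sub_self, integral_zero]
  ring

/-- Hankel's formula for the reciprocal of the Gamma function. -/
theorem hankelIntegral_exp_exp_sub {a : ℝ} (ha : -1 < a) (c : ℝ) :
    hankelIntegral (fun w => cexp (cexp w - a * w)) c =
      2 * π * I / (Real.Gamma (a + 1) : ℂ) := by
  have key : ∀ n : ℕ, ∀ a : ℝ, -1 < a → a < n →
      hankelIntegral (fun w => cexp (cexp w - a * w)) c =
        2 * π * I / (Real.Gamma (a + 1) : ℂ) := by
    intro n
    induction n with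
    | zero => intro a h1 h2; exact hankelIntegral_exp_exp_sub_of_neg (by simpa using h2) h1 c
    | succ n ih =>
      intro a h1 h2
      rcases lt_trichotomy a 0 with h | h | h
      · exact hankelIntegral_exp_exp_sub_of_neg h h1 c
      · subst h; simpa using hankelIntegral_exp_exp c
      · have h3 := hankelIntegral_exp_exp_sub_one a c
        push_cast at h2
        rw [ih (a - 1) (by linarith) (by linarith), sub_add_cancel] at h3
        rw [Real.Gamma_add_one h.ne', ofReal_mul, mul_comm (a : ℂ), ← div_div, h3,
          mul_div_cancel_left₀ _ (ofReal_ne_zero.2 h.ne')]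
  obtain ⟨n, hn⟩ := exists_nat_gt a
  exact key n a ha hn

theorem norm_ofReal_mul_exp_neg_mul {x : ℝ} (hx : 0 < x) (β : ℝ) (w : ℂ) :
    ‖(x : ℂ) * cexp (-β * w)‖ = x * Real.exp (-β * w.re) := by
  rw [norm_mul, Complex.norm_exp, Complex.norm_of_nonneg hx.le]; simp

theorem one_add_mul_exp_neg_mul_ne_zero {β x : ℝ} (hβ0 : 0 < β) (hβ1 : β < 1) (hx : 0 < x)
    {w : ℂ} (hw : |w.im| ≤ π) : 1 + (x : ℂ) * cexp (-β * w) ≠ 0 := by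
  intro h
  have him := congrArg Complex.im h
  have hre := congrArg Complex.re h
  simp [Complex.exp_re, Complex.exp_im] at him hre
  have hb := abs_le.1 hw
  have hsin : Real.sin (β * w.im) = 0 := by
    rcases him with h | h
    · exact absurd h hx.ne'
    · exact h
  rw [Real.sin_eq_zero_iff_of_lt_of_lt (by nlinarith [Real.pi_pos])
    (by nlinarith [Real.pi_pos])] at hsin
  rw [hsin, Real.cos_zero] at hre
  have := Real.exp_pos (-(β * w.re))
  nlinarith

theorem differentiableOn_exp_exp_div {β x : ℝ} (hβ0 : 0 < β) (hβ1 : β < 1) (hx : 0 < x) :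
    DifferentiableOn ℂ (fun w => cexp (cexp w) / (1 + (x : ℂ) * cexp (-β * w)))
      {w | |w.im| ≤ π} :=
  DifferentiableOn.div (Differentiable.differentiableOn (by fun_prop))
    (Differentiable.differentiableOn (by fun_prop))
    fun _ hw => one_add_mul_exp_neg_mul_ne_zero hβ0 hβ1 hx hw

theorem continuous_exp_exp_div_add_mul_I {β x b : ℝ} (hβ0 : 0 < β) (hβ1 : β < 1) (hx : 0 < x)
    (hb : |b| = π) : Continuous (fun y : ℝ =>
      cexp (cexp (y + b * I)) / (1 + (x : ℂ) * cexp (-β * (y + b * I)))) :=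
  (differentiableOn_exp_exp_div hβ0 hβ1 hx).continuousOn.comp_continuous
    (f := fun y : ℝ => (y : ℂ) + b * I) (by fun_prop) fun y => by simp [hb]

theorem norm_mul_exp_exp_div_le {β x b : ℝ} (hβ0 : 0 < β) (hβ1 : β < 1) (hx : 0 < x)
    (hb : |b| = π) (y : ℝ) :
    ‖(x : ℂ) * (cexp (cexp (y + b * I)) / (1 + (x : ℂ) * cexp (-β * (y + b * I))))‖ ≤
      Real.exp (-Real.exp y + β * y) / Real.sin (β * π) := by
  have hs : 0 < Real.sin (β * π) := Real.sin_pos_of_pos_of_lt_pi (by positivity)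
    (by nlinarith [Real.pi_pos])
  have hsb : |Real.sin (β * b)| = Real.sin (β * π) := by
    rw [← hb]
    rcases abs_cases b with h | h
    · rw [h.1, abs_of_pos]; rwa [← h.1, hb]
    · rw [h.1, mul_neg, Real.sin_neg, abs_of_neg]
      rw [← hb, h.1, mul_neg, Real.sin_neg] at hs; linarith
  have hcb : Real.cos b = -1 := by rw [← Real.cos_abs, hb, Real.cos_pi]
  have hden : x * Real.exp (-β * y) * Real.sin (β * π) ≤
      ‖1 + (x : ℂ) * cexp (-β * (y + b * I))‖ := by
    refine le_trans (le_of_eq ?_) (Complex.abs_im_le_norm _)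
    rw [← hsb]
    simp [Complex.exp_im, abs_mul, abs_of_pos hx]
    ring
  have hnum : ‖cexp (cexp (y + b * I))‖ = Real.exp (-Real.exp y) := by
    rw [Complex.norm_exp]; simp [Complex.exp_re, hcb]
  have hpos : 0 < x * Real.exp (-β * y) * Real.sin (β * π) := by positivity
  rw [norm_mul, norm_div, hnum, Complex.norm_of_nonneg hx.le]
  calc x * (Real.exp (-Real.exp y) / ‖1 + (x : ℂ) * cexp (-β * (y + b * I))‖)
      ≤ x * (Real.exp (-Real.exp y) / (x * Real.exp (-β * y) * Real.sin (β * π))) := by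
        gcongr
    _ = Real.exp (-Real.exp y + β * y) / Real.sin (β * π) := by
        rw [Real.exp_add, neg_mul, Real.exp_neg (β * y)]
        field_simp

theorem integrable_exp_exp_div {β x b : ℝ} (hβ0 : 0 < β) (hβ1 : β < 1) (hx : 0 < x)
    (hb : |b| = π) : Integrable (fun y : ℝ =>
      cexp (cexp (y + b * I)) / (1 + (x : ℂ) * cexp (-β * (y + b * I)))) := by
  have h : Integrable (fun y : ℝ => (x : ℂ) *
      (cexp (cexp (y + b * I)) / (1 + (x : ℂ) * cexp (-β * (y + b * I))))) :=
    ((integrable_exp_neg_exp_add_mul hβ0).div_const (Real.sin (β * π))).mono'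
      (continuous_const.mul
        (continuous_exp_exp_div_add_mul_I hβ0 hβ1 hx hb)).aestronglyMeasurable
      (.of_forall (norm_mul_exp_exp_div_le hβ0 hβ1 hx hb))
  refine (h.const_mul (x : ℂ)⁻¹).congr (.of_forall fun y => ?_)
  exact inv_mul_cancel_left₀ (ofReal_ne_zero.2 hx.ne') _

theorem tendsto_mul_integral_exp_exp_div {β b : ℝ} (hβ0 : 0 < β) (hβ1 : β < 1)
    (hb : |b| = π) : Tendsto (fun x : ℝ => (x : ℂ) * ∫ y : ℝ,
      cexp (cexp (y + b * I)) / (1 + (x : ℂ) * cexp (-β * (y + b * I)))) atTop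
      (𝓝 (Real.Gamma β * cexp (β * b * I))) := by
  have hlim : ∫ y : ℝ, (Real.exp (-Real.exp y + β * y) : ℂ) * cexp (β * b * I) =
      Real.Gamma β * cexp (β * b * I) := by
    rw [integral_mul_const, integral_complex_ofReal, integral_exp_neg_exp_add_mul hβ0]
  simp only [← integral_const_mul]
  rw [← hlim]
  refine tendsto_integral_filter_of_dominated_convergence
    (fun y => Real.exp (-Real.exp y + β * y) / Real.sin (β * π)) ?_ ?_
    ((integrable_exp_neg_exp_add_mul hβ0).div_const _) (.of_forall fun y => ?_)
  · filter_upwards [eventually_gt_atTop 0] with x hx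
    exact (continuous_const.mul
      (continuous_exp_exp_div_add_mul_I hβ0 hβ1 hx hb)).aestronglyMeasurable
  · filter_upwards [eventually_gt_atTop 0] with x hx
    exact .of_forall (norm_mul_exp_exp_div_le hβ0 hβ1 hx hb)
  · have hexp : cexp (y + b * I) = ((-Real.exp y : ℝ) : ℂ) := by
      rcases (abs_eq Real.pi_pos.le).1 hb with h | h <;> rw [h]
      · exact exp_ofReal_add_pi_mul_I y
      · exact exp_ofReal_add_neg_pi_mul_I y
    have hinv : Tendsto (fun x : ℝ => ((x⁻¹ : ℝ) : ℂ)) atTop (𝓝 0) := by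
      have h := (continuous_ofReal.tendsto 0).comp (tendsto_inv_atTop_zero (𝕜 := ℝ))
      rwa [ofReal_zero] at h
    have h := ((hinv.add_const (cexp (-β * (y + b * I)))).inv₀ (by simp)).const_mul
      (cexp (cexp (y + b * I)))
    have hl : cexp (cexp (y + b * I)) * (0 + cexp (-β * (y + b * I)))⁻¹ =
        (Real.exp (-Real.exp y + β * y) : ℂ) * cexp (β * b * I) := by
      rw [hexp, zero_add, ← Complex.exp_neg, ← Complex.exp_add, ofReal_exp, ← Complex.exp_add]
      congr 1; push_cast; ring
    rw [hl] at h
    refine h.congr' ?_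
    filter_upwards [eventually_gt_atTop 0] with x hx
    have hx' : (x : ℂ) ≠ 0 := ofReal_ne_zero.2 hx.ne'
    have : 1 + (x : ℂ) * cexp (-β * (y + b * I)) =
        x * (((x⁻¹ : ℝ) : ℂ) + cexp (-β * (y + b * I))) := by
      push_cast; field_simp
    rw [this, div_eq_mul_inv, mul_inv]
    field_simp

theorem hasSum_hankelIntegral {β x c : ℝ} (hx : 0 < x) (hβ0 : 0 < β)
    (hc : x * Real.exp (-β * c) < 1) :
    HasSum (fun n : ℕ => hankelIntegral
        (fun w => cexp (cexp w) * (-((x : ℂ) * cexp (-β * w))) ^ n) c)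
      (hankelIntegral (fun w => cexp (cexp w) / (1 + (x : ℂ) * cexp (-β * w))) c) := by
  set q := x * Real.exp (-β * c) with hq
  have hq0 : 0 ≤ q := by positivity
  have hle : ∀ w : ℂ, c ≤ w.re → ‖-((x : ℂ) * cexp (-β * w))‖ ≤ q := by
    intro w hw
    rw [norm_neg, norm_ofReal_mul_exp_neg_mul hx, hq]
    refine mul_le_mul_of_nonneg_left (Real.exp_le_exp.2 ?_) hx.le
    nlinarith
  have hbound : ∀ (n : ℕ) (w : ℂ), c ≤ w.re →
      ‖cexp (cexp w) * (-((x : ℂ) * cexp (-β * w))) ^ n‖ ≤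
        Real.exp (Real.exp w.re * Real.cos w.im) * q ^ n := by
    intro n w hw
    rw [norm_mul, norm_pow, Complex.norm_exp, Complex.exp_re]
    gcongr
    exact hle w hw
  have hsum : ∀ w : ℂ, c ≤ w.re →
      HasSum (fun n : ℕ => cexp (cexp w) * (-((x : ℂ) * cexp (-β * w))) ^ n)
        (cexp (cexp w) / (1 + (x : ℂ) * cexp (-β * w))) := by
    intro w hw
    have h := (hasSum_geometric_of_norm_lt_one ((hle w hw).trans_lt hc)).mul_left (cexp (cexp w))
    rwa [sub_neg_eq_add, ← div_eq_mul_inv] at h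
  have hgeom := summable_geometric_of_lt_one hq0 hc
  unfold hankelIntegral
  refine HasSum.add ?_ (HasSum.mul_left I ?_)
  · refine hasSum_integral_of_dominated_convergence
      (fun n y => 2 * Real.exp (-Real.exp y + 0 * y) * q ^ n)
      (fun n => Continuous.aestronglyMeasurable (by fun_prop)) (fun n => ?_)
      (.of_forall fun y => hgeom.mul_left _) ?_ ?_
    · refine (ae_restrict_mem measurableSet_Ioi).mono fun y hy => ?_
      have h1 := hbound n (y + π * I) (by simpa using (mem_Ioi.1 hy).le)
      have h2 := hbound n (y + (-π : ℝ) * I) (by simpa using (mem_Ioi.1 hy).le)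
      refine (norm_sub_le _ _).trans ((add_le_add h1 h2).trans (le_of_eq ?_))
      simp
      ring
    · simp only [tsum_mul_left]
      exact ((integrableOn_exp_neg_exp_add_mul 0 c).const_mul 2).mul_const _
    · refine (ae_restrict_mem measurableSet_Ioi).mono fun y hy => ?_
      exact (hsum _ (by simpa using (mem_Ioi.1 hy).le)).sub
        (hsum _ (by simpa using (mem_Ioi.1 hy).le))
  · refine intervalIntegral.hasSum_integral_of_dominated_convergence
      (fun n θ => Real.exp (Real.exp c * Real.cos θ) * q ^ n)
      (fun n => Continuous.aestronglyMeasurable (by fun_prop))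
      (fun n => .of_forall fun θ _ => ?_) (.of_forall fun θ _ => hgeom.mul_left _) ?_
      (.of_forall fun θ _ => hsum _ (by simp))
    · simpa using hbound n (c + θ * I) (by simp)
    · simp only [tsum_mul_left]
      exact Continuous.intervalIntegrable (by fun_prop) _ _

/-- The Mittag-Leffler function on the negative axis as the integral of a jump. -/
theorem mittagLeffler_neg_mul_eq_integral {β x : ℝ} (hβ0 : 0 < β) (hβ1 : β < 1) (hx : 0 < x) :
    (mittagLeffler β (-x) : ℂ) * (2 * π * I) =
      (∫ y : ℝ, cexp (cexp (y + π * I)) / (1 + (x : ℂ) * cexp (-β * (y + π * I)))) -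
      ∫ y : ℝ, cexp (cexp (y + (-π : ℝ) * I)) /
        (1 + (x : ℂ) * cexp (-β * (y + (-π : ℝ) * I))) := by
  have hup := integrable_exp_exp_div hβ0 hβ1 hx (abs_of_pos Real.pi_pos)
  have hlo := integrable_exp_exp_div (b := -π) hβ0 hβ1 hx (by rw [abs_neg, abs_of_pos Real.pi_pos])
  have hsmall : Tendsto (fun c : ℝ => x * Real.exp (-β * c)) atTop (𝓝 0) := by
    have : Tendsto (fun c : ℝ => -β * c) atTop atBot :=
      tendsto_id.const_mul_atTop_of_neg (by linarith)
    simpa using (Real.tendsto_exp_atBot.comp this).const_mul x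
  obtain ⟨c, hc⟩ := (hsmall.eventually_lt_const one_pos).exists
  have hterm : ∀ n : ℕ, hankelIntegral
      (fun w => cexp (cexp w) * (-((x : ℂ) * cexp (-β * w))) ^ n) c =
      (((-x) ^ n / Real.Gamma (β * n + 1) : ℝ) : ℂ) * (2 * π * I) := by
    intro n
    have h1 : ∀ w : ℂ, cexp (cexp w) * (-((x : ℂ) * cexp (-β * w))) ^ n =
        (-x : ℂ) ^ n * cexp (cexp w - ((β * n : ℝ) : ℂ) * w) := by
      intro w
      rw [← neg_mul, mul_pow, ← Complex.exp_nat_mul, sub_eq_add_neg, Complex.exp_add]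
      have : -(((β * n : ℝ) : ℂ) * w) = n * (-β * w) := by push_cast; ring
      rw [this]; ring
    have h2 := hankelIntegral_exp_exp_sub (a := β * n)
      (by have : 0 ≤ β * n := by positivity
          linarith) c
    simp only [h1]
    rw [hankelIntegral] at h2 ⊢
    simp only [← mul_sub]
    rw [integral_const_mul, intervalIntegral.integral_const_mul]
    push_cast at h2 ⊢
    linear_combination (-x : ℂ) ^ n * h2
  have hsum := hasSum_hankelIntegral hx hβ0 hc
  simp only [hterm] at hsum
  have hml := (hsum.div_const (2 * π * I)).tsum_eq
  simp only [mul_div_cancel_right₀ _ two_pi_I_ne_zero] at hml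
  rw [mittagLeffler, ofReal_tsum, hml, div_mul_cancel₀ _ two_pi_I_ne_zero,
    ← integral_sub hup hlo]
  refine hankelIntegral_eq_integral (g := fun c => Real.exp 1 * (2 / x * Real.exp (β * c)))
    (differentiableOn_exp_exp_div hβ0 hβ1 hx) (hup.sub hlo) ?_ ?_ c
  · have : Tendsto (fun c : ℝ => β * c) atBot atBot := tendsto_id.const_mul_atBot hβ0
    simpa using ((Real.tendsto_exp_atBot.comp this).const_mul (2 / x)).const_mul (Real.exp 1)
  · have hlarge : Tendsto (fun c : ℝ => x * Real.exp (-β * c)) atBot atTop :=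
      (Real.tendsto_exp_atTop.comp
        (tendsto_id.const_mul_atBot_of_neg (by linarith : -β < 0))).const_mul_atTop hx
    filter_upwards [eventually_le_atBot 0, hlarge.eventually_ge_atTop 2] with c hc h2 θ _
    have hnum : ‖cexp (cexp (c + θ * I))‖ ≤ Real.exp 1 := by
      rw [Complex.norm_exp]
      refine Real.exp_le_exp.2 ((Complex.re_le_norm _).trans ?_)
      rw [Complex.norm_exp]
      simpa using hc
    have hden : x * Real.exp (-β * c) / 2 ≤ ‖1 + (x : ℂ) * cexp (-β * (c + θ * I))‖ := by
      have h3 := norm_sub_norm_le ((x : ℂ) * cexp (-β * (c + θ * I))) (-1)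
      rw [sub_neg_eq_add, add_comm _ (1 : ℂ), norm_ofReal_mul_exp_neg_mul hx, norm_neg,
        norm_one] at h3
      simp only [add_re, ofReal_re, mul_re, I_re, mul_zero, ofReal_im, I_im, mul_one, sub_self,
        add_zero] at h3
      linarith
    have hpos : 0 < x * Real.exp (-β * c) / 2 := by positivity
    rw [norm_div]
    calc ‖cexp (cexp (c + θ * I))‖ / ‖1 + (x : ℂ) * cexp (-β * (c + θ * I))‖
        ≤ Real.exp 1 / (x * Real.exp (-β * c) / 2) := by gcongr
      _ = Real.exp 1 * (2 / x * Real.exp (β * c)) := by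
        rw [neg_mul, Real.exp_neg]; field_simp

theorem tendsto_mul_mittagLeffler_neg {β : ℝ} (hβ0 : 0 < β) (hβ1 : β < 1) :
    Tendsto (fun x : ℝ => x * mittagLeffler β (-x)) atTop
      (𝓝 (Real.sin (β * π) * Real.Gamma β / π)) := by
  have hup := tendsto_mul_integral_exp_exp_div hβ0 hβ1 (abs_of_pos Real.pi_pos)
  have hlo := tendsto_mul_integral_exp_exp_div (b := -π) hβ0 hβ1
    (by rw [abs_neg, abs_of_pos Real.pi_pos])
  have h := (hup.sub hlo).div_const (2 * π * I)
  have hl : (Real.Gamma β * cexp (β * π * I) - Real.Gamma β * cexp (β * (-π : ℝ) * I)) /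
      (2 * π * I) = ((Real.sin (β * π) * Real.Gamma β / π : ℝ) : ℂ) := by
    have hs := Complex.two_sin (β * π)
    have hpi : (π : ℂ) ≠ 0 := ofReal_ne_zero.2 Real.pi_ne_zero
    push_cast
    rw [div_eq_div_iff two_pi_I_ne_zero hpi,
      show (β : ℂ) * -π * I = -(β * π) * I by ring]
    linear_combination (-π * Real.Gamma β * I : ℂ) * hs -
      π * Real.Gamma β * (cexp (-(β * π) * I) - cexp (β * π * I)) * I_sq
  rw [hl] at h
  refine ((continuous_re.tendsto _).comp h).congr' ?_
  filter_upwards [eventually_gt_atTop 0] with x hx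
  rw [Function.comp_apply, ← mul_sub, ← mittagLeffler_neg_mul_eq_integral hβ0 hβ1 hx,
    ← mul_assoc, mul_div_cancel_right₀ _ two_pi_I_ne_zero, ← ofReal_mul, ofReal_re]

theorem mittagLeffler_asymptotics (β : ℝ) (hβ0 : 0 < β) (hβ1 : β < 1) :
    Tendsto (fun t : ℝ => t ^ β * mittagLeffler β (-(t ^ β))) atTop
      (nhds (Real.sin (β * Real.pi) * Real.Gamma β / Real.pi)) := by
  exact (tendsto_mul_mittagLeffler_neg hβ0 hβ1).comp (tendsto_rpow_atTop hβ0)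
end
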